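/- Let K, L ⊆ ℝⁿ be convex bodies and let λ ∈ (0,1). Then W((1−λ)K + λL) ≥ W(K)^{1−λ} · W(L)^{λ}, where (1−λ)K + λL denotes the Minkowski combination {(1−λ)x + λy : x ∈ K, y ∈ L}. -/

import Mathlib

open scoped Pointwise
open MeasureTheory Metric Real

/-- The Wills functional `W(K) = ∫_{ℝⁿ} e^{-π d(x,K)²} dx`. -/
noncomputable def wills {n : ℕ} (K : Set (EuclideanSpace ℝ (Fin n))) : ℝ :=
  ∫ x, Real.exp (-π * (Metric.infDist x K) ^ 2)

open scoped Pointwise ENNReal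

lemma bm_compact (A B C : Set ℝ) (hA : IsCompact A) (hB : IsCompact B) (hA0 : A.Nonempty)
    (hB0 : B.Nonempty) (h : ∀ x ∈ A, ∀ y ∈ B, x + y ∈ C) :
    volume A + volume B ≤ volume C := by
  obtain ⟨a, haA, ha⟩ := hA.exists_isGreatest hA0
  obtain ⟨b, hbB, hb⟩ := hB.exists_isLeast hB0
  have h1 : volume ((fun x => x + b) '' A) = volume A := by
    rw [Set.image_add_right, measure_preimage_add_right]
  have h2 : volume ((fun x => a + x) '' B) = volume B := by
    rw [Set.image_add_left, measure_preimage_add]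
  have hm : MeasurableSet ((fun x => a + x) '' B) :=
    (hB.image (by fun_prop)).measurableSet
  rw [← h1, ← h2, ← measure_union₀ hm.nullMeasurableSet]
  · apply measure_mono
    rintro _ (⟨x, hx, rfl⟩ | ⟨y, hy, rfl⟩)
    · exact h x hx b hbB
    · exact h a haA y hy
  · refine measure_mono_null (t := {a + b}) ?_ (by simp)
    rintro z ⟨⟨x, hx, rfl⟩, ⟨y, hy, hxy⟩⟩
    have := ha hx
    have := hb hy
    simp only at hxy
    simp only [Set.mem_singleton_iff]
    linarith

lemma bm_meas (A B C : Set ℝ) (hA : MeasurableSet A) (hB : MeasurableSet B) (hA0 : A.Nonempty)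
    (hB0 : B.Nonempty) (h : ∀ x ∈ A, ∀ y ∈ B, x + y ∈ C) :
    volume A + volume B ≤ volume C := by
  obtain ⟨a, ha⟩ := hA0
  obtain ⟨b, hb⟩ := hB0
  have key : ∀ K ⊆ A, IsCompact K → ∀ L ⊆ B, IsCompact L → volume K + volume L ≤ volume C := by
    intro K hKA hK L hLB hL
    have := bm_compact (insert a K) (insert b L) C (hK.insert a) (hL.insert b) (by simp) (by simp)
      (fun x hx y hy => h x (Set.insert_subset ha hKA hx) y (Set.insert_subset hb hLB hy))
    exact (add_le_add (measure_mono (Set.subset_insert _ _))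
      (measure_mono (Set.subset_insert _ _))).trans this
  refine le_of_forall_lt fun c hc => ?_
  by_cases hA' : volume A = 0
  · rw [hA', zero_add] at hc
    obtain ⟨L, hLB, hL, hcL⟩ := hB.exists_lt_isCompact hc
    have := key ∅ (by simp) isCompact_empty L hLB hL
    simp only [measure_empty, zero_add] at this
    exact hcL.trans_le this
  by_cases hB' : volume B = 0
  · rw [hB', add_zero] at hc
    obtain ⟨L, hLB, hL, hcL⟩ := hA.exists_lt_isCompact hc
    have := key L hLB hL ∅ (by simp) isCompact_empty
    simp only [measure_empty, add_zero] at this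
    exact hcL.trans_le this
  obtain ⟨r, hr, s, hs, hcrs⟩ := ENNReal.exists_lt_add_of_lt_add hc hA' hB'
  obtain ⟨K, hKA, hK, hcK⟩ := hA.exists_lt_isCompact hr
  obtain ⟨L, hLB, hL, hcL⟩ := hB.exists_lt_isCompact hs
  exact hcrs.trans_le ((add_le_add hcK.le hcL.le).trans (key K hKA hK L hLB hL))

lemma bm_weighted {p q : ℝ} (hp : 0 < p) (hq : 0 < q) (A B C : Set ℝ)
    (hA : MeasurableSet A) (hB : MeasurableSet B) (hA0 : A.Nonempty)
    (hB0 : B.Nonempty) (h : ∀ x ∈ A, ∀ y ∈ B, p * x + q * y ∈ C) :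
    ENNReal.ofReal p * volume A + ENNReal.ofReal q * volume B ≤ volume C := by
  have := bm_meas (p • A) (q • B) C (hA.const_smul₀ p) (hB.const_smul₀ q) (hA0.smul_set)
    (hB0.smul_set) (by
      rintro _ ⟨x, hx, rfl⟩ _ ⟨y, hy, rfl⟩
      exact h x hx y hy)
  simpa [Measure.addHaar_smul, abs_of_pos hp, abs_of_pos hq] using this

lemma amgm {p q : ℝ} (hp : 0 < p) (hq : 0 < q) (hpq : p + q = 1) (x y : ℝ≥0∞) :
    x ^ p * y ^ q ≤ ENNReal.ofReal p * x + ENNReal.ofReal q * y := by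
  by_cases hx : x = ∞
  · subst hx
    rw [ENNReal.mul_top (by simpa using hp)]; simp
  by_cases hy : y = ∞
  · subst hy
    rw [ENNReal.mul_top (by simpa using hq)]; simp
  lift x to NNReal using hx
  lift y to NNReal using hy
  rw [← ENNReal.coe_rpow_of_nonneg _ hp.le, ← ENNReal.coe_rpow_of_nonneg _ hq.le]
  have := NNReal.geom_mean_le_arith_mean2_weighted p.toNNReal q.toNNReal x y
    (by rw [← Real.toNNReal_add hp.le hq.le, hpq]; simp)
  rw [Real.coe_toNNReal _ hp.le, Real.coe_toNNReal _ hq.le] at this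
  rw [ENNReal.ofReal, ENNReal.ofReal]
  exact_mod_cast this

/-- One-dimensional Prékopa–Leindler for functions with supremum one. -/
lemma pl_normalized {p q : ℝ} (hp : 0 < p) (hq : 0 < q) (hpq : p + q = 1) (f g h : ℝ → ℝ≥0∞)
    (hf : Measurable f) (hg : Measurable g) (hh : Measurable h)
    (hf1 : ⨆ x, f x = 1) (hg1 : ⨆ x, g x = 1)
    (H : ∀ x y, f x ^ p * g y ^ q ≤ h (p * x + q * y)) :
    ENNReal.ofReal p * (∫⁻ x, f x) + ENNReal.ofReal q * (∫⁻ x, g x) ≤ ∫⁻ x, h x := by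
  have layer : ∀ u : ℝ → ℝ≥0∞, Measurable u → (∀ x, u x ≤ 1) →
      ∫⁻ x, u x = ∫⁻ (t : ℝ) in Set.Ioi 0, volume {x | ENNReal.ofReal t < u x} := by
    intro u hu hu1
    have hfin : ∀ x, u x ≠ ∞ := fun x => ((hu1 x).trans_lt ENNReal.one_lt_top).ne
    have := lintegral_eq_lintegral_meas_lt (f := fun x => (u x).toReal) volume
      (Filter.Eventually.of_forall fun x => ENNReal.toReal_nonneg) hu.ennreal_toReal.aemeasurable
    simp only [ENNReal.ofReal_toReal (hfin _)] at this
    rw [this]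
    refine setLIntegral_congr_fun measurableSet_Ioi fun t ht => ?_
    simp only [ENNReal.ofReal_lt_iff_lt_toReal (le_of_lt ht) (hfin _)]
  have hfle : ∀ x, f x ≤ 1 := fun x => hf1 ▸ le_iSup f x
  have hgle : ∀ x, g x ≤ 1 := fun x => hg1 ▸ le_iSup g x
  have hmeas : ∀ u : ℝ → ℝ≥0∞, Measurable fun t : ℝ => volume {x | ENNReal.ofReal t < u x} := by
    intro u
    refine Antitone.measurable fun s t hst => measure_mono fun x hx => ?_
    exact (ENNReal.ofReal_le_ofReal hst).trans_lt hx
  calc _ ≤ ∫⁻ x, min (h x) 1 := by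
        rw [layer f hf hfle, layer g hg hgle,
          layer (fun x => min (h x) 1) (hh.min measurable_const) (fun x => min_le_right _ _),
          ← lintegral_const_mul _ (hmeas f), ← lintegral_const_mul _ (hmeas g),
          ← lintegral_add_left ((hmeas f).const_mul _)]
        refine setLIntegral_mono' measurableSet_Ioi fun t ht => ?_
        rcases lt_or_ge t 1 with h1 | h1
        · have ht1 : ENNReal.ofReal t < 1 := by simpa using h1
          refine bm_weighted hp hq _ _ _ (measurableSet_lt measurable_const hf)
            (measurableSet_lt measurable_const hg) ?_ ?_ ?_
          · rw [← hf1] at ht1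
            exact lt_iSup_iff.1 ht1
          · rw [← hg1] at ht1
            exact lt_iSup_iff.1 ht1
          · intro x hx y hy
            simp only [Set.mem_setOf_eq] at hx hy ⊢
            refine lt_min (lt_of_lt_of_le ?_ (H x y)) ht1
            have h0 : ENNReal.ofReal t ≠ 0 := by simpa using ht
            calc ENNReal.ofReal t = ENNReal.ofReal t ^ p * ENNReal.ofReal t ^ q := by
                  rw [← ENNReal.rpow_add _ _ h0 ENNReal.ofReal_ne_top, hpq, ENNReal.rpow_one]
              _ < _ := ENNReal.mul_lt_mul (ENNReal.rpow_lt_rpow hx hp) (ENNReal.rpow_lt_rpow hy hq)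
        · have ht1 : 1 ≤ ENNReal.ofReal t := by simpa using h1
          have e1 : {x | ENNReal.ofReal t < f x} = ∅ := by
            ext x; simpa using (hfle x).trans ht1
          have e2 : {x | ENNReal.ofReal t < g x} = ∅ := by
            ext x; simpa using (hgle x).trans ht1
          simp [e1, e2]
    _ ≤ _ := lintegral_mono fun x => min_le_left _ _

lemma pl_bdd {p q : ℝ} (hp : 0 < p) (hq : 0 < q) (hpq : p + q = 1) (f g h : ℝ → ℝ≥0∞)
    (hf : Measurable f) (hg : Measurable g) (hh : Measurable h)
    (hf1 : ⨆ x, f x ≠ ∞) (hg1 : ⨆ x, g x ≠ ∞)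
    (H : ∀ x y, f x ^ p * g y ^ q ≤ h (p * x + q * y)) :
    (∫⁻ x, f x) ^ p * (∫⁻ x, g x) ^ q ≤ ∫⁻ x, h x := by
  set a := ⨆ x, f x with ha
  set b := ⨆ x, g x with hb
  by_cases ha0 : a = 0
  · have : ∀ x, f x = 0 := by simpa [ha] using ha0
    simp [this, hp]
  by_cases hb0 : b = 0
  · have : ∀ x, g x = 0 := by simpa [hb] using hb0
    simp [this, hq]
  set c := a ^ p * b ^ q with hc
  have hap0 : a ^ p ≠ 0 := by simp [ha0, hf1]
  have hbp0 : b ^ q ≠ 0 := by simp [hb0, hg1]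
  have hapt : a ^ p ≠ ∞ := ENNReal.rpow_ne_top_of_nonneg hp.le hf1
  have hbpt : b ^ q ≠ ∞ := ENNReal.rpow_ne_top_of_nonneg hq.le hg1
  have hc0 : c ≠ 0 := mul_ne_zero hap0 hbp0
  have hct : c ≠ ∞ := ENNReal.mul_ne_top hapt hbpt
  have key := pl_normalized hp hq hpq (fun x => a⁻¹ * f x) (fun x => b⁻¹ * g x)
    (fun x => c⁻¹ * h x) (hf.const_mul _) (hg.const_mul _) (hh.const_mul _)
    (by rw [← ENNReal.mul_iSup, ← ha, ENNReal.inv_mul_cancel ha0 hf1])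
    (by rw [← ENNReal.mul_iSup, ← hb, ENNReal.inv_mul_cancel hb0 hg1])
    (by
      intro x y
      rw [ENNReal.mul_rpow_of_nonneg _ _ hp.le, ENNReal.mul_rpow_of_nonneg _ _ hq.le, hc,
        ENNReal.mul_inv (Or.inl hap0) (Or.inl hapt), ENNReal.inv_rpow, ENNReal.inv_rpow,
        mul_mul_mul_comm]
      gcongr
      exact H x y)
  have key2 := (amgm hp hq hpq _ _).trans key
  rw [lintegral_const_mul _ hf, lintegral_const_mul _ hg, lintegral_const_mul _ hh,
    ENNReal.mul_rpow_of_nonneg _ _ hp.le, ENNReal.mul_rpow_of_nonneg _ _ hq.le,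
    mul_mul_mul_comm, ENNReal.inv_rpow, ENNReal.inv_rpow,
    ← ENNReal.mul_inv (Or.inl hap0) (Or.inl hapt), ← hc] at key2
  exact (ENNReal.mul_le_mul_iff_right (ENNReal.inv_ne_zero.2 hct) (ENNReal.inv_ne_top.2 hc0)).1 key2

lemma lintegral_trunc {f : ℝ → ℝ≥0∞} (hf : Measurable f) :
    ∫⁻ x, f x = ⨆ N : ℕ, ∫⁻ x, min (f x) N := by
  rw [← lintegral_iSup (fun N => hf.min measurable_const)]
  · congr with x
    have := inf_iSup_eq (f x) (fun N : ℕ => (N : ℝ≥0∞))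
    rw [ENNReal.iSup_natCast] at this
    simpa using this
  · intro N M hNM x
    exact min_le_min_left _ (by exact_mod_cast hNM)

lemma pl_one {p q : ℝ} (hp : 0 < p) (hq : 0 < q) (hpq : p + q = 1) (f g h : ℝ → ℝ≥0∞)
    (hf : Measurable f) (hg : Measurable g) (hh : Measurable h)
    (H : ∀ x y, f x ^ p * g y ^ q ≤ h (p * x + q * y)) :
    (∫⁻ x, f x) ^ p * (∫⁻ x, g x) ^ q ≤ ∫⁻ x, h x := by
  have hs : ∀ {r : ℝ} (hr : 0 < r) (u : ℕ → ℝ≥0∞), (⨆ N, u N) ^ r = ⨆ N, u N ^ r := by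
    intro r hr u
    have := (ENNReal.orderIsoRpow r hr).map_iSup u
    simpa only [ENNReal.orderIsoRpow_apply] using this
  have hb : ∀ (u : ℝ → ℝ≥0∞) (N : ℕ), ⨆ x, min (u x) N ≠ ∞ := fun u N =>
    ((iSup_le fun x => min_le_right _ _ : ⨆ x, min (u x) N ≤ N).trans_lt
      (ENNReal.natCast_lt_top N)).ne
  rw [lintegral_trunc hf, lintegral_trunc hg, hs hp, hs hq, ENNReal.iSup_mul]
  refine iSup_le fun N => ?_
  rw [ENNReal.mul_iSup]
  refine iSup_le fun M => ?_
  refine pl_bdd hp hq hpq _ _ h (hf.min measurable_const) (hg.min measurable_const) hh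
    (hb f N) (hb g M) fun x y => le_trans ?_ (H x y)
  gcongr <;> exact min_le_left _ _

/-- The Prékopa–Leindler inequality. -/
lemma pl {p q : ℝ} (hp : 0 < p) (hq : 0 < q) (hpq : p + q = 1) (n : ℕ) :
    ∀ (f g h : (Fin n → ℝ) → ℝ≥0∞)
    (_ : Measurable f) (_ : Measurable g) (_ : Measurable h)
    (_ : ∀ x y, f x ^ p * g y ^ q ≤ h (p • x + q • y)),
    (∫⁻ x, f x) ^ p * (∫⁻ x, g x) ^ q ≤ ∫⁻ x, h x := by
  induction n with
  | zero =>
    intro f g h hf hg hh H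
    have hv : volume (Set.univ : Set (Fin 0 → ℝ)) = 1 := by
      rw [Measure.volume_pi_eq_dirac]; simp
    simp only [lintegral_unique, hv, mul_one]
    convert H default default
  | succ n ih =>
    intro f g h hf hg hh H
    let e := MeasurableEquiv.piFinSuccAbove (fun _ : Fin (n + 1) => ℝ) 0
    have hme : MeasurePreserving e.symm volume volume :=
      (volume_preserving_piFinSuccAbove (fun _ : Fin (n + 1) => ℝ) 0).symm e
    have hint : ∀ u : (Fin (n + 1) → ℝ) → ℝ≥0∞, Measurable u →
        ∫⁻ x, u x = ∫⁻ t : ℝ, ∫⁻ z : Fin n → ℝ, u (e.symm (t, z)) := by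
      intro u hu
      rw [← hme.lintegral_comp hu]
      exact lintegral_prod _ (hu.comp e.symm.measurable).aemeasurable
    have hm : ∀ u : (Fin (n + 1) → ℝ) → ℝ≥0∞, Measurable u →
        Measurable fun t : ℝ => ∫⁻ z : Fin n → ℝ, u (e.symm (t, z)) := by
      intro u hu
      exact (hu.comp e.symm.measurable).lintegral_prod_right'
    have hm' : ∀ u : (Fin (n + 1) → ℝ) → ℝ≥0∞, Measurable u → ∀ t : ℝ,
        Measurable fun z : Fin n → ℝ => u (e.symm (t, z)) := by
      intro u hu t
      exact (hu.comp e.symm.measurable).comp measurable_prodMk_left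
    have hlin : ∀ (s t : ℝ) (z w : Fin n → ℝ), e.symm (p * s + q * t, p • z + q • w) =
        p • e.symm (s, z) + q • e.symm (t, w) := by
      intro s t z w
      ext i
      refine Fin.cases ?_ (fun j => ?_) i <;>
        simp [e, MeasurableEquiv.piFinSuccAbove, Fin.insertNthEquiv]
    rw [hint f hf, hint g hg, hint h hh]
    refine pl_one hp hq hpq _ _ _ (hm f hf) (hm g hg) (hm h hh) fun s t => ?_
    refine ih _ _ _ (hm' f hf s) (hm' g hg t) (hm' h hh _) fun z w => ?_
    rw [hlin]
    exact H _ _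

lemma infDist_comb {n : ℕ} {K L : Set (EuclideanSpace ℝ (Fin n))}
    (hK₁ : IsCompact K) (hK₃ : K.Nonempty) (hL₁ : IsCompact L) (hL₃ : L.Nonempty)
    {p q : ℝ} (hp : 0 < p) (hq : 0 < q) (x y : EuclideanSpace ℝ (Fin n)) :
    infDist (p • x + q • y) (p • K + q • L) ≤ p * infDist x K + q * infDist y L := by
  obtain ⟨a, ha, hxa⟩ := hK₁.exists_infDist_eq_dist hK₃ x
  obtain ⟨b, hb, hyb⟩ := hL₁.exists_infDist_eq_dist hL₃ y
  rw [hxa, hyb]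
  refine (infDist_le_dist_of_mem
    (Set.add_mem_add (Set.smul_mem_smul_set ha) (Set.smul_mem_smul_set hb))).trans ?_
  refine (dist_add_add_le _ _ _ _).trans ?_
  rw [dist_smul₀, dist_smul₀, Real.norm_of_nonneg hp.le, Real.norm_of_nonneg hq.le]

lemma wills_lintegral {n : ℕ} (K : Set (EuclideanSpace ℝ (Fin n))) :
    wills K = (∫⁻ x : Fin n → ℝ,
      ENNReal.ofReal (Real.exp (-π * (infDist (WithLp.toLp 2 x) K) ^ 2))).toReal := by
  have hc : Continuous fun x : EuclideanSpace ℝ (Fin n) =>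
      Real.exp (-π * (infDist x K) ^ 2) := by
    have := continuous_infDist_pt K
    fun_prop
  rw [wills, integral_eq_lintegral_of_nonneg_ae (Filter.Eventually.of_forall fun x => by positivity)
    hc.aestronglyMeasurable]
  congr 1
  exact ((PiLp.volume_preserving_toLp (Fin n)).lintegral_comp
    hc.measurable.ennreal_ofReal).symm

lemma wills_finite {n : ℕ} (K : Set (EuclideanSpace ℝ (Fin n))) (hK : IsCompact K)
    (hK0 : K.Nonempty) : ∫⁻ x : Fin n → ℝ,
      ENNReal.ofReal (Real.exp (-π * (infDist (WithLp.toLp 2 x) K) ^ 2)) ≠ ∞ := by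
  have hc : Continuous fun x : EuclideanSpace ℝ (Fin n) =>
      Real.exp (-π * (infDist x K) ^ 2) := by
    have := continuous_infDist_pt K
    fun_prop
  rw [(PiLp.volume_preserving_toLp (Fin n)).lintegral_comp (f := fun x =>
    ENNReal.ofReal (Real.exp (-π * (infDist x K) ^ 2))) hc.measurable.ennreal_ofReal]
  obtain ⟨R, hR⟩ := hK.isBounded.exists_norm_le
  have hG : Integrable (fun v : EuclideanSpace ℝ (Fin n) => Real.exp (-(π/2) * ‖v‖ ^ 2)) := by
    have := (GaussianFourier.integrable_cexp_neg_mul_sq_norm_add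
      (V := EuclideanSpace ℝ (Fin n)) (b := ((π/2 : ℝ) : ℂ)) (by
        rw [Complex.ofReal_re]; positivity) 0 0).norm
    refine this.congr (Filter.Eventually.of_forall fun v => ?_)
    simp only [Complex.norm_exp, zero_mul, add_zero]
    norm_cast
  have hI : Integrable (fun x : EuclideanSpace ℝ (Fin n) =>
      Real.exp (-π * (infDist x K) ^ 2)) := by
    refine (hG.const_mul (Real.exp (π * R ^ 2))).mono' hc.aestronglyMeasurable
      (Filter.Eventually.of_forall fun x => ?_)
    rw [Real.norm_of_nonneg (by positivity), ← Real.exp_add, Real.exp_le_exp]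
    obtain ⟨a, ha, hxa⟩ := hK.exists_infDist_eq_dist hK0 x
    have h1 : ‖x‖ ≤ infDist x K + R := by
      rw [hxa, dist_eq_norm]
      have := norm_add_le (x - a) a
      rw [sub_add_cancel] at this
      linarith [hR a ha]
    have h2 : ‖x‖ ^ 2 ≤ 2 * infDist x K ^ 2 + 2 * R ^ 2 := by
      have := pow_le_pow_left₀ (norm_nonneg x) h1 2
      nlinarith [sq_nonneg (infDist x K - R)]
    nlinarith [Real.pi_pos]
  exact hI.lintegral_lt_top.ne

/-- The Wills functional is log-concave with respect to Minkowski
combinations: `W((1-λ)K + λL) ≥ W(K)^{1-λ} W(L)^λ`. -/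
theorem wills_log_concave {n : ℕ} (K L : Set (EuclideanSpace ℝ (Fin n)))
    (hK₁ : IsCompact K) (hK₂ : Convex ℝ K) (hK₃ : K.Nonempty)
    (hL₁ : IsCompact L) (hL₂ : Convex ℝ L) (hL₃ : L.Nonempty)
    {l : ℝ} (hl : l ∈ Set.Ioo (0 : ℝ) 1) :
    wills ((1 - l) • K + l • L) ≥ wills K ^ (1 - l) * wills L ^ l := by
  obtain ⟨hq, hl1⟩ := hl
  have hp : 0 < 1 - l := by linarith
  have hpq : 1 - l + l = 1 := by ring
  generalize 1 - l = p at hp hpq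
  have hM : IsCompact (p • K + l • L) := (hK₁.smul p).add (hL₁.smul l)
  have hM0 : (p • K + l • L).Nonempty := hK₃.smul_set.add hL₃.smul_set
  have hm : ∀ A : Set (EuclideanSpace ℝ (Fin n)), Measurable fun x : Fin n → ℝ =>
      ENNReal.ofReal (Real.exp (-π * (infDist (WithLp.toLp 2 x) A) ^ 2)) := by
    intro A
    have hc : Continuous fun x : EuclideanSpace ℝ (Fin n) =>
        Real.exp (-π * (infDist x A) ^ 2) := by
      have := continuous_infDist_pt A
      fun_prop
    exact (hc.measurable.comp (WithLp.measurable_toLp 2 _)).ennreal_ofReal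
  rw [ge_iff_le, wills_lintegral, wills_lintegral, wills_lintegral, ENNReal.toReal_rpow,
    ENNReal.toReal_rpow, ← ENNReal.toReal_mul]
  refine ENNReal.toReal_mono (wills_finite _ hM hM0) ?_
  refine pl hp hq hpq n _ _ _ (hm K) (hm L) (hm _) fun x y => ?_
  rw [ENNReal.ofReal_rpow_of_pos (Real.exp_pos _), ENNReal.ofReal_rpow_of_pos (Real.exp_pos _),
    ← ENNReal.ofReal_mul (by positivity), ← Real.exp_mul, ← Real.exp_mul, ← Real.exp_add]
  refine ENNReal.ofReal_le_ofReal (Real.exp_le_exp.2 ?_)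
  have h := infDist_comb hK₁ hK₃ hL₁ hL₃ hp hq (WithLp.toLp 2 x) (WithLp.toLp 2 y)
  rw [WithLp.toLp_add, WithLp.toLp_smul, WithLp.toLp_smul]
  have h0 : 0 ≤ infDist (p • WithLp.toLp 2 x + l • WithLp.toLp 2 y) (p • K + l • L) :=
    infDist_nonneg
  generalize infDist (p • WithLp.toLp 2 x + l • WithLp.toLp 2 y) (p • K + l • L) = c at h h0
  generalize infDist (WithLp.toLp 2 x) K = a at h
  generalize infDist (WithLp.toLp 2 y) L = b at h
  have h1 : c ^ 2 ≤ p * a ^ 2 + l * b ^ 2 := by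
    have h2 := pow_le_pow_left₀ h0 h 2
    have h3 : p * a ^ 2 + l * b ^ 2 - (p * a + l * b) ^ 2 = p * l * (a - b) ^ 2 := by
      obtain rfl : p = 1 - l := by linarith
      ring
    have : 0 ≤ p * l * (a - b) ^ 2 := by positivity
    linarith
  nlinarith [Real.pi_pos]
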